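/- Let 0 < q < d, set e = d/q, and let g : [q,d] → ℝ be measurable with h(u) = g(uq) for u ∈ [1,e]. If W^{[q,d]} is a (q,d)-Slepian process and W^{[1,e]} is a (1,e)-Slepian process, then P(∃ t ∈ [q,d], W^{[q,d]}_t > g(t)) = P(∃ u ∈ [1,e], W^{[1,e]}_u > h(u)). -/

import Mathlib

open MeasureTheory ProbabilityTheory Real

/-- A `(q,d)`-Slepian process: a centered stationary Gaussian process on `[q,d]`
with continuous sample paths and covariance `C(s,t) = (1 − (t−s)/q)⁺`. -/
structure SlepianProcess (Ω : Type*) [MeasurableSpace Ω] (P : Measure Ω)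
    [IsProbabilityMeasure P] (q d : ℝ) where
  W : ℝ → Ω → ℝ
  meas : ∀ t, Measurable (W t)
  centered : ∀ t ∈ Set.Icc q d, ∫ ω, W t ω ∂P = 0
  cov : ∀ s t : ℝ, q ≤ s → s ≤ t → t ≤ d →
    ∫ ω, W s ω * W t ω ∂P = max (1 - (t - s) / q) 0
  gaussian : ∀ (n : ℕ) (c ts : Fin n → ℝ), (∀ i, ts i ∈ Set.Icc q d) →
    ∃ v : NNReal, Measure.map (fun ω => ∑ i, c i * W (ts i) ω) P = gaussianReal 0 v
  cont : ∀ ω, ContinuousOn (fun t => W t ω) (Set.Icc q d)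

theorem SlepianProcess.memLp_two {Ω : Type*} [MeasurableSpace Ω] {P : Measure Ω}
    [IsProbabilityMeasure P] {q d : ℝ} (S : SlepianProcess Ω P q d) {t : ℝ}
    (ht : t ∈ Set.Icc q d) : MemLp (S.W t) 2 P := by
  obtain ⟨v, hv⟩ := S.gaussian 1 (fun _ => 1) (fun _ => t) (fun _ => ht)
  simp only [Fin.sum_univ_one, one_mul] at hv
  have h : MemLp id 2 (P.map (S.W t)) := by
    change Measure.map (S.W t) P = _ at hv
    rw [hv]
    exact memLp_id_gaussianReal' 2 (by simp)
  exact (memLp_map_measure_iff (by fun_prop) (S.meas t).aemeasurable).1 h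

theorem SlepianProcess.law_sum {Ω : Type*} [MeasurableSpace Ω] {P : Measure Ω}
    [IsProbabilityMeasure P] {q d : ℝ} (S : SlepianProcess Ω P q d)
    {ι : Type*} [Fintype ι] (c ts : ι → ℝ) (hts : ∀ i, ts i ∈ Set.Icc q d) :
    P.map (fun ω => ∑ i, c i * S.W (ts i) ω)
      = gaussianReal 0 (∑ i, ∑ j, c i * c j * max (1 - |ts i - ts j| / q) 0).toNNReal := by
  obtain ⟨v, hv⟩ := S.gaussian (Fintype.card ι) (fun k => c ((Fintype.equivFin ι).symm k))
    (fun k => ts ((Fintype.equivFin ι).symm k)) (fun _ => hts _)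
  have e : ∀ ω, ∑ k, c ((Fintype.equivFin ι).symm k) * S.W (ts ((Fintype.equivFin ι).symm k)) ω
      = ∑ i, c i * S.W (ts i) ω := fun ω =>
    Equiv.sum_comp (Fintype.equivFin ι).symm (fun i => c i * S.W (ts i) ω)
  simp only [e] at hv
  rw [hv]
  congr 1
  have hm : Measurable (fun ω => ∑ i, c i * S.W (ts i) ω) :=
    Finset.measurable_sum _ fun i _ => (S.meas _).const_mul _
  have h1 : ∫ ω, (∑ i, c i * S.W (ts i) ω) ^ 2 ∂P = v := by
    have h2 : ∫ x, x ^ 2 ∂(P.map (fun ω => ∑ i, c i * S.W (ts i) ω)) = v := by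
      rw [hv]
      have := variance_fun_id_gaussianReal (μ := 0) (v := v)
      rw [variance_of_integral_eq_zero (by fun_prop) integral_id_gaussianReal] at this
      exact this
    rw [integral_map hm.aemeasurable (by fun_prop)] at h2
    exact h2
  have hint : ∀ i j, Integrable (fun ω => S.W (ts i) ω * S.W (ts j) ω) P := fun i j =>
    (S.memLp_two (hts i)).integrable_mul (S.memLp_two (hts j))
  have hc : ∀ i j, ∫ ω, S.W (ts i) ω * S.W (ts j) ω ∂P = max (1 - |ts i - ts j| / q) 0 := by
    intro i j
    rcases le_total (ts i) (ts j) with h | h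
    · rw [S.cov _ _ (hts i).1 h (hts j).2, abs_of_nonpos (by linarith), neg_sub]
    · simp_rw [mul_comm (S.W (ts i) _)]
      rw [S.cov _ _ (hts j).1 h (hts i).2, abs_of_nonneg (by linarith)]
  have h3 : ∫ ω, (∑ i, c i * S.W (ts i) ω) ^ 2 ∂P
      = ∑ i, ∑ j, c i * c j * max (1 - |ts i - ts j| / q) 0 := by
    simp_rw [sq, Finset.sum_mul_sum, mul_mul_mul_comm (c _)]
    rw [integral_finsetSum _ fun i _ => integrable_finsetSum _ fun j _ => (hint i j).const_mul _]
    refine Finset.sum_congr rfl fun i _ => ?_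
    rw [integral_finsetSum _ fun j _ => (hint i j).const_mul _]
    refine Finset.sum_congr rfl fun j _ => ?_
    rw [integral_const_mul, hc]
  rw [← h3, h1, Real.toNNReal_coe]

theorem map_pi_eq_of_sum {Ω₁ Ω₂ : Type*} [MeasurableSpace Ω₁] [MeasurableSpace Ω₂]
    {P₁ : Measure Ω₁} {P₂ : Measure Ω₂} [IsProbabilityMeasure P₁] [IsProbabilityMeasure P₂]
    {ι : Type*} [Fintype ι] (X : ι → Ω₁ → ℝ) (Y : ι → Ω₂ → ℝ)
    (hX : ∀ i, Measurable (X i)) (hY : ∀ i, Measurable (Y i))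
    (h : ∀ c : ι → ℝ, P₁.map (fun ω => ∑ i, c i * X i ω) = P₂.map (fun ω => ∑ i, c i * Y i ω)) :
    P₁.map (fun ω i => X i ω) = P₂.map (fun ω i => Y i ω) := by
  classical
  have mX : Measurable (fun ω i => X i ω) := measurable_pi_lambda _ hX
  have mY : Measurable (fun ω i => Y i ω) := measurable_pi_lambda _ hY
  have := Measure.isProbabilityMeasure_map (μ := P₁) mX.aemeasurable
  have := Measure.isProbabilityMeasure_map (μ := P₂) mY.aemeasurable
  refine Measure.ext_of_charFunDual (funext fun L => ?_)
  rw [charFunDual_eq_charFun_map_one, charFunDual_eq_charFun_map_one,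
    Measure.map_map (by fun_prop) mX, Measure.map_map (by fun_prop) mY]
  have hL : ∀ x : ι → ℝ, L x = ∑ i, L (Pi.single i 1) * x i := by
    intro x
    conv_lhs => rw [pi_eq_sum_univ' x]
    simp only [map_sum, map_smul, smul_eq_mul, mul_comm]
  have := h (fun i => L (Pi.single i 1))
  have a1 : (L ∘ fun ω i => X i ω) = fun ω => ∑ i, L (Pi.single i 1) * X i ω := funext fun ω => hL _
  have a2 : (L ∘ fun ω i => Y i ω) = fun ω => ∑ i, L (Pi.single i 1) * Y i ω := funext fun ω => hL _
  rw [a1, a2, this]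

theorem exists_countable_cross (q d : ℝ) (g : ℝ → ℝ) :
    ∃ T : Set (Set.Icc q d), T.Countable ∧ ∀ f : ℝ → ℝ, ContinuousOn f (Set.Icc q d) →
      ((∃ t ∈ Set.Icc q d, f t > g t) ↔ ∃ t : T, f t > g t) := by
  obtain ⟨T, hT, hU⟩ := TopologicalSpace.isOpen_iUnion_countable
    (fun t : Set.Icc q d => {f : C(Set.Icc q d, ℝ) | f t > g t})
    (fun t => isOpen_lt continuous_const (continuous_eval_const t))
  refine ⟨T, hT, fun f hf => ?_⟩
  have := Set.ext_iff.1 hU ⟨_, hf.domRestrict⟩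
  simp only [Set.mem_iUnion, Set.mem_ofPred_eq, ContinuousMap.coe_mk, Set.domRestrict_apply] at this
  constructor
  · rintro ⟨t, ht, h⟩
    obtain ⟨s, hs, h'⟩ := this.2 ⟨⟨t, ht⟩, h⟩
    exact ⟨⟨s, hs⟩, h'⟩
  · rintro ⟨t, h⟩
    exact ⟨t, t.1.2, h⟩

/-- Reduction of the boundary crossing probability of a `(q,d)`-Slepian process to that
of a `(1, d/q)`-Slepian process. -/
theorem stmt2 {Ω₁ Ω₂ : Type*} [MeasurableSpace Ω₁] [MeasurableSpace Ω₂]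
    {P₁ : Measure Ω₁} {P₂ : Measure Ω₂} [IsProbabilityMeasure P₁] [IsProbabilityMeasure P₂]
    (q d : ℝ) (hq : 0 < q) (hqd : q < d)
    (S₁ : SlepianProcess Ω₁ P₁ q d) (S₂ : SlepianProcess Ω₂ P₂ 1 (d / q))
    (g : ℝ → ℝ) (hg : Measurable g) :
    P₁ {ω | ∃ t ∈ Set.Icc q d, S₁.W t ω > g t}
      = P₂ {ω | ∃ u ∈ Set.Icc 1 (d / q), S₂.W u ω > g (u * q)} := by
  have hmem : ∀ t ∈ Set.Icc q d, t / q ∈ Set.Icc 1 (d / q) := fun t ht =>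
    ⟨(one_le_div hq).2 ht.1, by gcongr; exact ht.2⟩
  obtain ⟨T, hT, hcross⟩ := exists_countable_cross q d g
  have : Countable T := hT.to_subtype
  have e1 : {ω | ∃ t ∈ Set.Icc q d, S₁.W t ω > g t}
      = (fun ω (t : T) => S₁.W t ω) ⁻¹' {x : T → ℝ | ∃ t : T, x t > g t} := by
    ext ω
    exact hcross _ (S₁.cont ω)
  have e2 : {ω | ∃ u ∈ Set.Icc 1 (d / q), S₂.W u ω > g (u * q)}
      = (fun ω (t : T) => S₂.W (t / q) ω) ⁻¹' {x : T → ℝ | ∃ t : T, x t > g t} := by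
    ext ω
    have hc : ContinuousOn (fun t => S₂.W (t / q) ω) (Set.Icc q d) :=
      (S₂.cont ω).comp (by fun_prop) hmem
    refine Iff.trans ?_ (hcross _ hc)
    constructor
    · rintro ⟨u, hu, h⟩
      refine ⟨u * q, ⟨?_, ?_⟩, ?_⟩
      · nlinarith [hu.1]
      · exact (le_div_iff₀ hq).1 hu.2
      · simpa [hq.ne'] using h
    · rintro ⟨t, ht, h⟩
      refine ⟨t / q, hmem t ht, ?_⟩
      rwa [div_mul_cancel₀ _ hq.ne']
  have hA : MeasurableSet {x : T → ℝ | ∃ t : T, x t > g t} := by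
    rw [Set.ofPred_exists]
    exact MeasurableSet.iUnion fun t => measurableSet_lt measurable_const (measurable_pi_apply t)
  have m1 : Measurable (fun ω (t : T) => S₁.W t ω) := measurable_pi_lambda _ fun t => S₁.meas _
  have m2 : Measurable (fun ω (t : T) => S₂.W (t / q) ω) :=
    measurable_pi_lambda _ fun t => S₂.meas _
  rw [e1, e2, ← Measure.map_apply m1 hA, ← Measure.map_apply m2 hA]
  congr 1
  have l1 := isProjectiveLimit_map (P := P₁) (X := fun (t : T) ω => S₁.W t ω) m1.aemeasurable
  have l2 := isProjectiveLimit_map (P := P₂) (X := fun (t : T) ω => S₂.W (t / q) ω) m2.aemeasurable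
  have hfin : ∀ I : Finset T, P₁.map (fun ω => I.restrict (fun t : T => S₁.W t ω))
      = P₂.map (fun ω => I.restrict (fun t : T => S₂.W (t / q) ω)) := by
    intro I
    refine map_pi_eq_of_sum (fun (i : I) ω => S₁.W i ω) (fun (i : I) ω => S₂.W (i / q) ω)
      (fun i => S₁.meas _) (fun i => S₂.meas _) fun c => ?_
    rw [S₁.law_sum c (fun i : I => (i : ℝ)) (fun i => i.1.1.2),
      S₂.law_sum c (fun i : I => (i : ℝ) / q) (fun i => hmem _ i.1.1.2)]
    simp only [← sub_div, abs_div, abs_of_pos hq, div_one]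
  simp_rw [hfin] at l1
  exact l1.unique l2
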